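/- Let G be a finite simple graph on vertex set [n] and p ∈ [0,1)^n. If Z_G(−p; S) > 0 for every S ⊆ [n], and f is a supermodular function with f(∅) > 0 that factorizes according to p, G, then for every T ⊆ [n], f(T) ≥ f(∅) · Z_G(−p; T) > 0. -/

import Mathlib

open Finset

variable {n : ℕ}

open Classical in
/-- Independent set polynomial of the subgraph of `G` induced by `S`, i.e. `Z_G(x; S)`. -/
noncomputable def Zpoly (G : SimpleGraph (Fin n)) (x : Fin n → ℝ) (S : Finset (Fin n)) : ℝ :=
  ∑ I ∈ S.powerset.filter (fun I => ∀ a ∈ I, ∀ b ∈ I, ¬ G.Adj a b), ∏ i ∈ I, x i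

/-- `f : 2^{[n]} → ℝ` is supermodular: discrete derivatives are increasing. -/
def Supermodular (f : Finset (Fin n) → ℝ) : Prop :=
  ∀ (i : Fin n) (S T : Finset (Fin n)), S ⊆ T → i ∉ T →
    f (insert i S) - f S ≤ f (insert i T) - f T

/-- `f` factorizes according to `p, G`: `f(S ∪ {i}) ≥ (1 - p_i) f(S)` whenever `S` contains
neither `i` nor any neighbor of `i`. -/
def Factorizes (f : Finset (Fin n) → ℝ) (p : Fin n → ℝ) (G : SimpleGraph (Fin n)) : Prop :=
  ∀ (i : Fin n) (S : Finset (Fin n)), (∀ j ∈ S, j ≠ i ∧ ¬ G.Adj i j) →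
    (1 - p i) * f S ≤ f (insert i S)

theorem Zpoly_empty (G : SimpleGraph (Fin n)) (x : Fin n → ℝ) : Zpoly G x ∅ = 1 := by
  simp [Zpoly, Finset.filter_singleton]

open Classical in
/-- Deletion recurrence for the independent set polynomial. -/
theorem Zpoly_insert (G : SimpleGraph (Fin n)) (x : Fin n → ℝ) {i : Fin n}
    {T : Finset (Fin n)} (hi : i ∉ T) :
    Zpoly G x (insert i T) = Zpoly G x T + x i * Zpoly G x (T.filter fun j => ¬ G.Adj i j) := by
  unfold Zpoly
  rw [Finset.sum_filter, Finset.sum_powerset_insert hi, ← Finset.sum_filter, ← Finset.sum_filter,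
    Finset.mul_sum]
  congr 1
  refine Finset.sum_congr ?_ fun I hI => ?_
  · ext I
    simp only [Finset.mem_filter, Finset.mem_powerset, Finset.forall_mem_insert,
      Finset.subset_iff]
    have h1 := G.loopless.irrefl i
    have h2 := fun j => G.adj_comm i j
    grind
  · refine Finset.prod_insert fun h => hi ?_
    simp only [Finset.mem_filter, Finset.mem_powerset] at hI
    exact Finset.mem_of_mem_filter i (hI.1 h)

/-- The ratio `f / Z_G(-p; ·)` is monotone, stated without division. -/
theorem Supermodular.mul_Zpoly_le {G : SimpleGraph (Fin n)} {p : Fin n → ℝ}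
    (hp : ∀ i, 0 ≤ p i) (hZ : ∀ S : Finset (Fin n), 0 < Zpoly G (fun i => -p i) S)
    {f : Finset (Fin n) → ℝ} (hsm : Supermodular f) (hfac : Factorizes f p G)
    {S U : Finset (Fin n)} (hSU : S ⊆ U) :
    f S * Zpoly G (fun i => -p i) U ≤ f U * Zpoly G (fun i => -p i) S := by
  classical
  induction U using Finset.strongInduction generalizing S with
  | H U ih =>
    obtain rfl | hne := eq_or_ne S U
    · exact le_rfl
    obtain ⟨i, hiU, hiS⟩ := Finset.exists_of_ssubset (hSU.ssubset_of_ne hne)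
    obtain ⟨T, hiT, rfl⟩ : ∃ T, i ∉ T ∧ insert i T = U :=
      ⟨U.erase i, Finset.notMem_erase i U, Finset.insert_erase hiU⟩
    have hlt := Finset.ssubset_insert hiT
    have hST := ih T hlt ((Finset.subset_insert_iff_of_notMem hiS).1 hSU)
    set R := T.filter fun j => ¬ G.Adj i j with hR
    have hRT : R ⊆ T := Finset.filter_subset _ _
    have hratio := ih T hlt hRT
    have hderiv := hsm i R T hRT hiT
    have hdrop := hfac i R fun j hj => by
      rw [hR, Finset.mem_filter] at hj
      exact ⟨fun h => hiT (h ▸ hj.1), hj.2⟩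
    have hrec := Zpoly_insert G (fun i => -p i) hiT
    rw [← hR] at hrec
    have hstep : f T * Zpoly G (fun i => -p i) (insert i T) ≤
        f (insert i T) * Zpoly G (fun i => -p i) T := by
      have h1 : f T - p i * f R ≤ f (insert i T) := by linarith
      have h2 := mul_le_mul_of_nonneg_right h1 (hZ T).le
      have h3 := mul_le_mul_of_nonneg_left hratio (hp i)
      rw [hrec]
      linarith
    have h4 := mul_le_mul_of_nonneg_right hST (hZ (insert i T)).le
    have h5 := mul_le_mul_of_nonneg_right hstep (hZ S).le
    refine le_of_mul_le_mul_right ?_ (hZ T)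
    linarith

/-- If `Z_G(-p; S) > 0` for every `S`, and `f` is a nonnegative supermodular
function with `f(∅) > 0` that factorizes according to `p, G`, then
`f(T) ≥ f(∅) · Z_G(-p; T) > 0` for every `T ⊆ [n]`. -/
theorem supermodular_shearer_lower_bound (G : SimpleGraph (Fin n)) (p : Fin n → ℝ)
    (hp : ∀ i, 0 ≤ p i ∧ p i < 1)
    (hZ : ∀ S : Finset (Fin n), 0 < Zpoly G (fun i => -p i) S)
    (f : Finset (Fin n) → ℝ) (hf0 : ∀ S, 0 ≤ f S)
    (hsm : Supermodular f) (hfe : 0 < f ∅) (hfac : Factorizes f p G) :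
    ∀ T : Finset (Fin n),
      f ∅ * Zpoly G (fun i => -p i) T ≤ f T ∧ 0 < f ∅ * Zpoly G (fun i => -p i) T := by
  intro T
  refine ⟨?_, mul_pos hfe (hZ T)⟩
  simpa [Zpoly_empty] using hsm.mul_Zpoly_le (fun i => (hp i).1) hZ hfac (Finset.empty_subset T)
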